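/- arXiv:1107.1161 — 13 statements merged into one kernel-verified Lean document; each statement's English description precedes it below -/
import Mathlib

section
/- A Boolean function f : B^n → B is locally monotone (i.e., 2-locally monotone) if and only if for every k ∈ [n] and all x, y ∈ B^n one has |Δ_k f(x) − Δ_k f(y)| ≤ Σ_{i ∈ [n]\{k}} |x_i − y_i|. -/
open Finset

/-- Discrete partial derivative: `Δ_k f (x) = f(x_k^1) - f(x_k^0)`. -/
def pderiv {ι : Type*} [DecidableEq ι] (f : (ι → Bool) → ℝ) (k : ι) (x : ι → Bool) : ℝ :=
  f (Function.update x k true) - f (Function.update x k false)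

/-- Meet derivative: `∧_k f (x) = f(x_k^0) ⊓ f(x_k^1)`. -/
def meetD {ι : Type*} [DecidableEq ι] (f : (ι → Bool) → ℝ) (k : ι) (x : ι → Bool) : ℝ :=
  min (f (Function.update x k false)) (f (Function.update x k true))

/-- Join derivative: `∨_k f (x) = f(x_k^0) ⊔ f(x_k^1)`. -/
def joinD {ι : Type*} [DecidableEq ι] (f : (ι → Bool) → ℝ) (k : ι) (x : ι → Bool) : ℝ :=
  max (f (Function.update x k false)) (f (Function.update x k true))

/-- `f` is `p`-locally monotone: no partial derivative changes sign on tuples differing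
in fewer than `p` positions (other than the `k`-th one). -/
def LocallyMonotone {n : ℕ} (p : ℕ) (f : (Fin n → Bool) → ℝ) : Prop :=
  ∀ k : Fin n, ∀ x y : Fin n → Bool,
    (Finset.univ.filter (fun i => i ≠ k ∧ x i ≠ y i)).card < p →
    0 ≤ pderiv f k x * pderiv f k y

/-- A lattice-derivative operator: `(true, k)` is `∨_k`, `(false, k)` is `∧_k`. -/
def latD {ι : Type*} [DecidableEq ι] (ok : Bool × ι) (f : (ι → Bool) → ℝ) : (ι → Bool) → ℝ :=
  if ok.1 then joinD f ok.2 else meetD f ok.2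

/-- Composition `O_{k_1} ⋯ O_{k_p} f` of the operators listed in `l`. -/
def applyOps {ι : Type*} [DecidableEq ι] (l : List (Bool × ι)) (f : (ι → Bool) → ℝ) :
    (ι → Bool) → ℝ := l.foldr latD f

/-- `f` has `p`-permutable lattice derivatives. -/
def Permutable {ι : Type*} [DecidableEq ι] (p : ℕ) (f : (ι → Bool) → ℝ) : Prop :=
  ∀ l l' : List (Bool × ι), l.length = p → (l.map Prod.snd).Nodup → l.Perm l' →
    applyOps l f = applyOps l' f

/-- `f` is monotone: each partial derivative is everywhere nonnegative or everywhere
nonpositive. -/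
def IsMonotoneFn {ι : Type*} [DecidableEq ι] (f : (ι → Bool) → ℝ) : Prop :=
  ∀ k : ι, (∀ x, 0 ≤ pderiv f k x) ∨ (∀ x, pderiv f k x ≤ 0)

/-- The tuple `a_S^x`: `i`-th component `x i` if `i ∈ S`, and `a i` otherwise. -/
def restrictTo {n : ℕ} (S : Finset (Fin n)) (a : Fin n → Bool) (x : {i // i ∈ S} → Bool) :
    Fin n → Bool := fun i => if h : i ∈ S then x ⟨i, h⟩ else a i

/-- `g` is an `S`-section of `f`. -/
def IsSection {n : ℕ} (S : Finset (Fin n)) (f : (Fin n → Bool) → ℝ)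
    (g : ({i // i ∈ S} → Bool) → ℝ) : Prop :=
  ∃ a : Fin n → Bool, ∀ x, g x = f (restrictTo S a x)

/-- A Boolean function viewed as real-valued. -/
def toReal {n : ℕ} (f : (Fin n → Bool) → Bool) : (Fin n → Bool) → ℝ :=
  fun x => if f x then 1 else 0

lemma pderiv_toReal_mem {n : ℕ} (f : (Fin n → Bool) → Bool) (k : Fin n) (x : Fin n → Bool) :
    pderiv (toReal f) k x = -1 ∨ pderiv (toReal f) k x = 0 ∨ pderiv (toReal f) k x = 1 := by
  unfold pderiv toReal
  split_ifs <;> norm_num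

lemma pderiv_congr {ι : Type*} [DecidableEq ι] (f : (ι → Bool) → ℝ) {k : ι} {x y : ι → Bool}
    (h : ∀ i, i ≠ k → x i = y i) : pderiv f k x = pderiv f k y := by
  have key (a : Bool) : Function.update x k a = Function.update y k a := by
    ext i
    by_cases hi : i = k
    · subst hi; simp
    · simp [hi, h i hi]
  simp only [pderiv, key]

theorem stmt1 {n : ℕ} (f : (Fin n → Bool) → Bool) :
    LocallyMonotone 2 (toReal f) ↔
      ∀ k : Fin n, ∀ x y : Fin n → Bool,
        |pderiv (toReal f) k x - pderiv (toReal f) k y| ≤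
          ((Finset.univ.filter (fun i => i ≠ k ∧ x i ≠ y i)).card : ℝ) := by
  refine forall₃_congr fun k x y => ?_
  rcases Nat.eq_zero_or_pos (Finset.univ.filter (fun i => i ≠ k ∧ x i ≠ y i)).card with h | h
  · have hxy : pderiv (toReal f) k x = pderiv (toReal f) k y := by
      refine pderiv_congr _ fun i hi => ?_
      by_contra hne
      exact Finset.notMem_empty i (Finset.card_eq_zero.mp h ▸ by simp [hi, hne])
    simp [h, hxy, mul_self_nonneg]
  · generalize (Finset.univ.filter (fun i => i ≠ k ∧ x i ≠ y i)).card = d at h ⊢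
    rcases (show d = 1 ∨ 2 ≤ d by omega) with rfl | h2
    · rcases pderiv_toReal_mem f k x with hx | hx | hx <;>
        rcases pderiv_toReal_mem f k y with hy | hy | hy <;> rw [hx, hy] <;> norm_num
    · have hd : (2 : ℝ) ≤ d := by exact_mod_cast h2
      refine iff_of_true (fun hlt => absurd hlt (by omega)) (le_trans ?_ hd)
      rcases pderiv_toReal_mem f k x with hx | hx | hx <;>
        rcases pderiv_toReal_mem f k y with hy | hy | hy <;> rw [hx, hy] <;> norm_num
end

section
/- A pseudo-Boolean function f : B^n → ℝ is p-locally monotone if and only if every p-ary section of f is monotone. -/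
open Finset

theorem restrictTo_update {n : ℕ} (S : Finset (Fin n)) (a : Fin n → Bool)
    (x : {i // i ∈ S} → Bool) (k : {i // i ∈ S}) (b : Bool) :
    restrictTo S a (Function.update x k b) = Function.update (restrictTo S a x) k.1 b := by
  funext i
  by_cases hi : i ∈ S <;> by_cases hk : i = k.1 <;>
    simp_all [restrictTo, Subtype.ext_iff]

theorem pderiv_restrictTo {n : ℕ} {S : Finset (Fin n)} {a : Fin n → Bool}
    {f : (Fin n → Bool) → ℝ} {g : ({i // i ∈ S} → Bool) → ℝ}
    (hg : ∀ x, g x = f (restrictTo S a x)) (k : {i // i ∈ S}) (x : {i // i ∈ S} → Bool) :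
    pderiv g k x = pderiv f k.1 (restrictTo S a x) := by
  simp only [pderiv, hg, restrictTo_update]

theorem restrictTo_eq_of_agree {n : ℕ} {S : Finset (Fin n)} {x y : Fin n → Bool}
    (h : ∀ i ∉ S, x i = y i) : restrictTo S x (fun i => y i.1) = y := by
  funext i
  by_cases hi : i ∈ S <;> simp [restrictTo, hi, h]

theorem stmt4 {n : ℕ} (p : ℕ) (hp : 1 ≤ p) (hpn : p ≤ n) (f : (Fin n → Bool) → ℝ) :
    LocallyMonotone p f ↔
      ∀ S : Finset (Fin n), S.card = p →
        ∀ g : ({i // i ∈ S} → Bool) → ℝ, IsSection S f g → IsMonotoneFn g := by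
  constructor
  · rintro hf S hS g ⟨a, hg⟩ k
    by_contra! ⟨⟨x, hx⟩, y, hy⟩
    rw [pderiv_restrictTo hg] at hx hy
    refine (mul_neg_of_neg_of_pos hx hy).not_ge (hf k.1 _ _ ?_)
    refine (Finset.card_le_card (t := S.erase k.1) fun i hi => ?_).trans_lt ?_
    · simp only [Finset.mem_filter, Finset.mem_univ, true_and] at hi
      refine Finset.mem_erase.2 ⟨hi.1, ?_⟩
      by_contra hiS
      simp [restrictTo, hiS] at hi
    · rw [← hS]
      exact Finset.card_erase_lt_of_mem k.2
  · intro h k x y hxy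
    obtain ⟨S, hsub, hS⟩ := Finset.exists_superset_card_eq
      ((Finset.card_insert_le k _).trans hxy) (by simpa using hpn)
    have hk : k ∈ S := hsub (Finset.mem_insert_self _ _)
    have hagree : ∀ i ∉ S, x i = y i := by
      intro i hi
      by_contra hne
      refine hi (hsub (Finset.mem_insert_of_mem ?_))
      simp only [Finset.mem_filter, Finset.mem_univ, true_and]
      exact ⟨fun hik => hi (hik ▸ hk), hne⟩
    have key := h S hS (fun z => f (restrictTo S x z)) ⟨x, fun _ => rfl⟩ ⟨k, hk⟩
    simp only [pderiv_restrictTo (fun _ => rfl)] at key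
    rcases key with key | key
    all_goals
      have hx := key (fun i => x i.1)
      have hy := key (fun i => y i.1)
      rw [restrictTo_eq_of_agree fun _ _ => rfl] at hx
      rw [restrictTo_eq_of_agree hagree] at hy
    · exact mul_nonneg hx hy
    · exact mul_nonneg_of_nonpos_of_nonpos hx hy
end

section
/- A Boolean function f : B^n → B (with n ≥ 2) is locally monotone (i.e., 2-locally monotone) if and only if neither the binary Boolean sum (x,y) ↦ x ⊕ y nor its negation (x,y) ↦ x ⊕ y ⊕ 1 occurs as a binary section of f. -/
open Finset

/-- `g` is a binary section of the Boolean function `f`. -/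
def IsBinSectionB {n : ℕ} (f : (Fin n → Bool) → Bool) (g : Bool → Bool → Bool) : Prop :=
  ∃ j k : Fin n, j ≠ k ∧ ∃ a : Fin n → Bool,
    ∀ u v : Bool, g u v = f (Function.update (Function.update a j u) k v)

/-- Two parallel edges of a two-dimensional face have derivatives of opposite signs exactly when
the section on that face is the Boolean sum or its negation. -/
theorem zero_le_pderiv_mul_pderiv_iff {n : ℕ} (f : (Fin n → Bool) → Bool) (j k : Fin n)
    (a : Fin n → Bool) :
    0 ≤ pderiv (toReal f) k (Function.update a j false) *
        pderiv (toReal f) k (Function.update a j true) ↔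
      ¬ (∀ u v : Bool, xor u v = f (Function.update (Function.update a j u) k v)) ∧
      ¬ (∀ u v : Bool, (!(xor u v)) = f (Function.update (Function.update a j u) k v)) := by
  simp only [pderiv, toReal, Bool.forall_bool]
  cases f (Function.update (Function.update a j false) k false) <;>
  cases f (Function.update (Function.update a j false) k true) <;>
  cases f (Function.update (Function.update a j true) k false) <;>
  cases f (Function.update (Function.update a j true) k true) <;>
  norm_num

/-- A function is `2`-locally monotone as soon as its derivatives do not change sign between
parallel edges of two-dimensional faces. -/
theorem locallyMonotone_two_iff {n : ℕ} (f : (Fin n → Bool) → ℝ) :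
    LocallyMonotone 2 f ↔ ∀ j k : Fin n, j ≠ k → ∀ a : Fin n → Bool,
      0 ≤ pderiv f k (Function.update a j false) * pderiv f k (Function.update a j true) := by
  constructor
  · intro h j k _ a
    refine h k _ _ (Nat.lt_succ_of_le (Finset.card_le_one.2 ?_))
    have key : ∀ i, i ∈ Finset.univ.filter (fun i => i ≠ k ∧
        Function.update a j false i ≠ Function.update a j true i) → i = j := by
      intro i hi
      by_contra hij
      simp [hij] at hi
    intro b hb c hc
    rw [key b hb, key c hc]
  · intro h k x y hxy
    have agree : ∀ z : Fin n → Bool, (∀ i, i ≠ k → z i = y i) → pderiv f k z = pderiv f k y := by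
      intro z hz
      have hu : ∀ b, Function.update z k b = Function.update y k b := by
        intro b
        ext i
        by_cases hi : i = k
        · subst hi; simp
        · simp [hi, hz i hi]
      simp only [pderiv, hu]
    by_cases hd : ∃ j, j ≠ k ∧ x j ≠ y j
    · obtain ⟨j, hjk, hj⟩ := hd
      have hy : pderiv f k (Function.update x j (y j)) = pderiv f k y := by
        refine agree _ fun i hi => ?_
        by_cases hij : i = j
        · subst hij; simp
        · rw [Function.update_of_ne hij]
          by_contra hne
          exact hij (Finset.card_le_one.1 (Nat.le_of_lt_succ hxy) i (by simp [hi, hne]) j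
            (by simp [hjk, hj]))
      have hx : Function.update x j (x j) = x := Function.update_eq_self j x
      have hface := h j k hjk x
      rw [← hy, ← congrArg (pderiv f k) hx]
      cases hxj : x j <;> cases hyj : y j <;> simp_all [mul_comm]
    · push Not at hd
      rw [agree x hd]
      exact mul_self_nonneg _

theorem stmt6 {n : ℕ} (hn : 2 ≤ n) (f : (Fin n → Bool) → Bool) :
    LocallyMonotone 2 (toReal f) ↔
      ¬ IsBinSectionB f (fun u v => xor u v) ∧
      ¬ IsBinSectionB f (fun u v => !(xor u v)) := by
  rw [locallyMonotone_two_iff]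
  simp only [zero_le_pderiv_mul_pderiv_iff, IsBinSectionB]
  constructor
  · intro h
    exact ⟨fun ⟨j, k, hjk, a, ha⟩ => (h j k hjk a).1 ha,
      fun ⟨j, k, hjk, a, ha⟩ => (h j k hjk a).2 ha⟩
  · rintro ⟨h₁, h₂⟩ j k hjk a
    exact ⟨fun ha => h₁ ⟨j, k, hjk, a, ha⟩, fun ha => h₂ ⟨j, k, hjk, a, ha⟩⟩
end

section
/- If a pseudo-Boolean function f : B^n → ℝ is locally monotone (i.e., 2-locally monotone), then ∨_k∧_j f = ∧_j∨_k f for all j, k ∈ [n] with j ≠ k. -/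
open Finset

/-- Median-type identity for the four values of a function on the square with
no sign change of its partial differences. -/
theorem max_min_eq_min_max_of_mul_nonneg {a b c d : ℝ} (hk : 0 ≤ (b - a) * (d - c))
    (hj : 0 ≤ (c - a) * (d - b)) :
    max (min a c) (min b d) = min (max a b) (max c d) := by
  rcases mul_nonneg_iff.1 hk with ⟨h1, h2⟩ | ⟨h1, h2⟩ <;>
  rcases mul_nonneg_iff.1 hj with ⟨h3, h4⟩ | ⟨h3, h4⟩ <;> grind

/-- Partial derivatives of a 2-locally monotone function keep their sign when one further
coordinate is changed. -/
theorem LocallyMonotone.pderiv_update_mul_nonneg {n : ℕ} {f : (Fin n → Bool) → ℝ}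
    (h : LocallyMonotone 2 f) (j k : Fin n) (x : Fin n → Bool) (a b : Bool) :
    0 ≤ pderiv f k (Function.update x j a) * pderiv f k (Function.update x j b) := by
  refine h k _ _ (lt_of_le_of_lt (card_le_card (t := {j}) fun i hi => ?_) (by simp))
  by_contra hij
  simp_all

theorem stmt7 {n : ℕ} (f : (Fin n → Bool) → ℝ) (h : LocallyMonotone 2 f) :
    ∀ j k : Fin n, j ≠ k → joinD (meetD f j) k = meetD (joinD f k) j := by
  intro j k hjk
  funext x
  have hk := h.pderiv_update_mul_nonneg j k x false true
  have hj := h.pderiv_update_mul_nonneg k j x false true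
  simp only [pderiv, Function.update_comm hjk.symm] at hk hj
  simp only [joinD, meetD, Function.update_comm hjk.symm]
  exact max_min_eq_min_max_of_mul_nonneg hk hj
end

section
/- Let f : B^n → ℝ be a pseudo-Boolean function and p ∈ [n]. Then (a) for all α, β ∈ ℝ with α ≠ 0, f has p-permutable lattice derivatives if and only if αf + β has p-permutable lattice derivatives; and (b) for any subset of variables, f has p-permutable lattice derivatives if and only if the function obtained from f by negating those variables (replacing x_i by 1 − x_i) has p-permutable lattice derivatives. -/
open Finset

/-- The operator on the same variable, with meet and join exchanged when `s` is true. -/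
def flipOp {ι : Type*} (s : Bool) (ok : Bool × ι) : Bool × ι := (xor s ok.1, ok.2)

theorem latD_affine {ι : Type*} [DecidableEq ι] {α : ℝ} (β : ℝ) (ok : Bool × ι)
    (f : (ι → Bool) → ℝ) :
    latD ok (fun x => α * f x + β) =
      fun x => α * latD (flipOp (decide (α < 0)) ok) f x + β := by
  obtain ⟨o, k⟩ := ok
  funext x
  rcases lt_or_ge α 0 with h | h
  · cases o <;>
      simp [latD, flipOp, meetD, joinD, h, min_add_add_right, max_add_add_right,
        (antitone_mul_left h.le).map_min, (antitone_mul_left h.le).map_max]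
  · cases o <;>
      simp [latD, flipOp, meetD, joinD, h.not_gt, min_add_add_right, max_add_add_right,
        mul_min_of_nonneg _ _ h, mul_max_of_nonneg _ _ h]

theorem applyOps_affine {ι : Type*} [DecidableEq ι] {α : ℝ} (β : ℝ) (l : List (Bool × ι))
    (f : (ι → Bool) → ℝ) :
    applyOps l (fun x => α * f x + β) =
      fun x => α * applyOps (l.map (flipOp (decide (α < 0)))) f x + β := by
  induction l with
  | nil => rfl
  | cons ok l ih =>
    change latD ok (applyOps l _) = _
    rw [ih, latD_affine]
    rfl

theorem Permutable.affine {ι : Type*} [DecidableEq ι] {p : ℕ} {f : (ι → Bool) → ℝ}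
    (hf : Permutable p f) (α β : ℝ) : Permutable p (fun x => α * f x + β) := by
  intro l l' hl hnd hperm
  rw [applyOps_affine, applyOps_affine,
    hf _ (l'.map (flipOp (decide (α < 0)))) (by simpa using hl) _ (hperm.map _)]
  rw [List.map_map]
  exact hnd

/-- The tuple obtained from `x` by negating the components in `T`. -/
def negateOn {ι : Type*} [DecidableEq ι] (T : Finset ι) (x : ι → Bool) : ι → Bool :=
  fun i => if i ∈ T then !(x i) else x i

theorem negateOn_negateOn {ι : Type*} [DecidableEq ι] (T : Finset ι) (x : ι → Bool) :
    negateOn T (negateOn T x) = x := by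
  funext i
  by_cases h : i ∈ T <;> simp [negateOn, h]

theorem negateOn_update {ι : Type*} [DecidableEq ι] (T : Finset ι) (x : ι → Bool) (k : ι)
    (a : Bool) :
    negateOn T (Function.update x k a) =
      Function.update (negateOn T x) k (if k ∈ T then !a else a) := by
  funext i
  by_cases h : i = k
  · subst h
    simp [negateOn]
  · simp [negateOn, h]

theorem latD_negateOn {ι : Type*} [DecidableEq ι] (T : Finset ι) (ok : Bool × ι)
    (f : (ι → Bool) → ℝ) :
    latD ok (fun x => f (negateOn T x)) = fun x => latD ok f (negateOn T x) := by
  obtain ⟨o, k⟩ := ok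
  funext x
  by_cases h : k ∈ T <;> cases o <;>
    simp [latD, meetD, joinD, negateOn_update, h, min_comm, max_comm]

theorem applyOps_negateOn {ι : Type*} [DecidableEq ι] (T : Finset ι) (l : List (Bool × ι))
    (f : (ι → Bool) → ℝ) :
    applyOps l (fun x => f (negateOn T x)) = fun x => applyOps l f (negateOn T x) := by
  induction l with
  | nil => rfl
  | cons ok l ih =>
    change latD ok (applyOps l _) = _
    rw [ih, latD_negateOn]
    rfl

theorem Permutable.negateOn {ι : Type*} [DecidableEq ι] {p : ℕ} {f : (ι → Bool) → ℝ}
    (hf : Permutable p f) (T : Finset ι) : Permutable p (fun x => f (negateOn T x)) := by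
  intro l l' hl hnd hperm
  rw [applyOps_negateOn, applyOps_negateOn, hf l l' hl hnd hperm]

theorem stmt9 {n : ℕ} (p : ℕ) (hp : 1 ≤ p) (hpn : p ≤ n) (f : (Fin n → Bool) → ℝ) :
    (∀ α β : ℝ, α ≠ 0 →
      (Permutable p f ↔ Permutable p (fun x => α * f x + β))) ∧
    (∀ T : Finset (Fin n),
      Permutable p f ↔
        Permutable p (fun x => f (fun i => if i ∈ T then !(x i) else x i))) := by
  refine ⟨fun α β hα => ⟨fun hf => hf.affine α β, fun hf => ?_⟩,
    fun T => ⟨fun hf => hf.negateOn T, fun hf => ?_⟩⟩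
  · have h := hf.affine α⁻¹ (-(α⁻¹ * β))
    have e : (fun x => α⁻¹ * (α * f x + β) + -(α⁻¹ * β)) = f := by
      funext x
      field_simp
      ring
    rwa [e] at h
  · have h := hf.negateOn T
    change Permutable p (fun x => f (negateOn T (negateOn T x))) at h
    simpa only [negateOn_negateOn] using h
end

section
/- A pseudo-Boolean function f : B^n → ℝ (with n ≥ 2) has 2-permutable lattice derivatives if and only if every binary section g of f satisfies a_1·a_12 ≥ 0, or a_2·a_12 ≥ 0, or |a_12| ≤ max(|a_1|, |a_2|), where a_1 = g(1,0) − g(0,0), a_2 = g(0,1) − g(0,0) and a_12 = g(1,1) − g(1,0) − g(0,1) + g(0,0) are the coefficients of the multilinear representation g(x_1,x_2) = a_0 + a_1 x_1 + a_2 x_2 + a_12 x_1 x_2. -/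
open Finset

/-- `g` is a binary section of `f` (variables `j ≠ k`, other variables fixed to `a`). -/
def IsBinSection {n : ℕ} (f : (Fin n → Bool) → ℝ) (g : Bool → Bool → ℝ) : Prop :=
  ∃ j k : Fin n, j ≠ k ∧ ∃ a : Fin n → Bool,
    ∀ u v : Bool, g u v = f (Function.update (Function.update a j u) k v)

theorem meetD_comm {ι : Type*} [DecidableEq ι] (f : (ι → Bool) → ℝ) {j k : ι} (h : j ≠ k) :
    meetD (meetD f k) j = meetD (meetD f j) k := by
  funext x
  simp only [meetD, Function.update_comm h]
  exact inf_inf_inf_comm _ _ _ _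

theorem joinD_comm {ι : Type*} [DecidableEq ι] (f : (ι → Bool) → ℝ) {j k : ι} (h : j ≠ k) :
    joinD (joinD f k) j = joinD (joinD f j) k := by
  funext x
  simp only [joinD, Function.update_comm h]
  exact sup_sup_sup_comm _ _ _ _

/-- Permutability of order two only concerns one meet and one join derivative. -/
theorem permutable_two_iff {ι : Type*} [DecidableEq ι] (f : (ι → Bool) → ℝ) :
    Permutable 2 f ↔ ∀ j k : ι, j ≠ k → meetD (joinD f k) j = joinD (meetD f j) k := by
  constructor
  · intro h j k hjk
    simpa [applyOps, latD] using
      h [(false, j), (true, k)] [(true, k), (false, j)] rfl (by simpa using hjk)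
        (List.Perm.swap _ _ _)
  · intro h l l' hl hnd hp
    match l, hl with
    | [(o, j), (o', k)], _ =>
      have hjk : j ≠ k := by simpa using hnd
      rcases List.pair_perm.mp hp with rfl | rfl
      · rfl
      · cases o <;> cases o' <;> simp only [applyOps, List.foldr, latD, if_true, if_false,
          Bool.false_eq_true]
        · exact meetD_comm f hjk
        · exact h j k hjk
        · exact (h k j hjk.symm).symm
        · exact joinD_comm f hjk

/-- A minimum of maxima over a `2 × 2` array differs from the maximum of minima exactly when
the two diagonals are strictly separated. -/
theorem min_max_eq_max_min_iff {α : Type*} [LinearOrder α] (p q r s : α) :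
    min (max p r) (max q s) = max (min p q) (min r s) ↔
      ¬ ((p < q ∧ p < r ∧ s < q ∧ s < r) ∨ (q < p ∧ r < p ∧ q < s ∧ r < s)) := by
  grind (splits := 20)

/-- The coefficient condition says that the diagonals of the array are not strictly separated. -/
theorem coeff_condition_iff {α : Type*} [Field α] [LinearOrder α] [IsStrictOrderedRing α]
    (p q r s : α) :
    ((q - p) * (s - q - r + p) ≥ 0 ∨ (r - p) * (s - q - r + p) ≥ 0 ∨
        |s - q - r + p| ≤ max |q - p| |r - p|) ↔
      ¬ ((p < q ∧ p < r ∧ s < q ∧ s < r) ∨ (q < p ∧ r < p ∧ q < s ∧ r < s)) := by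
  rw [← not_iff_not, not_not]
  simp only [not_or, not_le, ge_iff_le, max_lt_iff, mul_neg_iff]
  constructor
  · rintro ⟨h1 | h1, h2 | h2, h3, h4⟩
    · rw [abs_of_neg h1.2, abs_of_pos h1.1] at h3
      rw [abs_of_neg h1.2, abs_of_pos h2.1] at h4
      left; refine ⟨?_, ?_, ?_, ?_⟩ <;> linarith
    · linarith
    · linarith
    · rw [abs_of_pos h1.2, abs_of_neg h1.1] at h3
      rw [abs_of_pos h1.2, abs_of_neg h2.1] at h4
      right; refine ⟨?_, ?_, ?_, ?_⟩ <;> linarith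
  · rintro (⟨h1, h2, h3, h4⟩ | ⟨h1, h2, h3, h4⟩)
    · have h : s - q - r + p < 0 := by linarith
      rw [abs_of_neg h, abs_of_pos (sub_pos.mpr h1), abs_of_pos (sub_pos.mpr h2)]
      refine ⟨.inl ⟨?_, h⟩, .inl ⟨?_, h⟩, ?_, ?_⟩ <;> linarith
    · have h : 0 < s - q - r + p := by linarith
      rw [abs_of_pos h, abs_of_neg (sub_neg.mpr h1), abs_of_neg (sub_neg.mpr h2)]
      refine ⟨.inr ⟨?_, h⟩, .inr ⟨?_, h⟩, ?_, ?_⟩ <;> linarith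

/-- The two mixed derivatives agree at `a` iff the binary section through `a` satisfies the
coefficient condition. -/
theorem meetD_joinD_eq_iff {ι : Type*} [DecidableEq ι] (f : (ι → Bool) → ℝ) {j k : ι}
    (hjk : j ≠ k) (a : ι → Bool) (g : Bool → Bool → ℝ)
    (hg : ∀ u v : Bool, g u v = f (Function.update (Function.update a j u) k v)) :
    meetD (joinD f k) j a = joinD (meetD f j) k a ↔
      (g true false - g false false) *
          (g true true - g true false - g false true + g false false) ≥ 0 ∨
        (g false true - g false false) *
          (g true true - g true false - g false true + g false false) ≥ 0 ∨
        |g true true - g true false - g false true + g false false| ≤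
          max |g true false - g false false| |g false true - g false false| := by
  rw [coeff_condition_iff, ← min_max_eq_max_min_iff]
  simp only [meetD, joinD, Function.update_comm hjk.symm, hg]

theorem stmt11 {n : ℕ} (hn : 2 ≤ n) (f : (Fin n → Bool) → ℝ) :
    Permutable 2 f ↔
      ∀ g : Bool → Bool → ℝ, IsBinSection f g →
        (g true false - g false false) *
            (g true true - g true false - g false true + g false false) ≥ 0 ∨
        (g false true - g false false) *
            (g true true - g true false - g false true + g false false) ≥ 0 ∨
        |g true true - g true false - g false true + g false false| ≤
          max |g true false - g false false| |g false true - g false false| := by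
  rw [permutable_two_iff]
  constructor
  · rintro h g ⟨j, k, hjk, a, hg⟩
    exact (meetD_joinD_eq_iff f hjk a g hg).mp (congrFun (h j k hjk) a)
  · intro h j k hjk
    funext a
    exact (meetD_joinD_eq_iff f hjk a _ fun _ _ => rfl).mpr (h _ ⟨j, k, hjk, a, fun _ _ => rfl⟩)
end

section
/- If a pseudo-Boolean function f : B^n → ℝ is monotone, then ∧_j f and ∨_j f are monotone for every j ∈ [n]. -/
open Finset

theorem IsMonotoneFn.meetD {ι : Type*} [DecidableEq ι] {f : (ι → Bool) → ℝ}
    (h : IsMonotoneFn f) (j : ι) : IsMonotoneFn (meetD f j) := by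
  intro k
  obtain rfl | hkj := eq_or_ne k j
  · simp [pderiv, _root_.meetD]
  · refine (h k).imp (fun hk x => sub_nonneg.2 ?_) (fun hk x => sub_nonpos.2 ?_) <;>
    · simp only [_root_.meetD, Function.update_comm hkj]
      first
      | exact min_le_min (sub_nonneg.1 (hk _)) (sub_nonneg.1 (hk _))
      | exact min_le_min (sub_nonpos.1 (hk _)) (sub_nonpos.1 (hk _))

theorem IsMonotoneFn.joinD {ι : Type*} [DecidableEq ι] {f : (ι → Bool) → ℝ}
    (h : IsMonotoneFn f) (j : ι) : IsMonotoneFn (joinD f j) := by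
  intro k
  obtain rfl | hkj := eq_or_ne k j
  · simp [pderiv, _root_.joinD]
  · refine (h k).imp (fun hk x => sub_nonneg.2 ?_) (fun hk x => sub_nonpos.2 ?_) <;>
    · simp only [_root_.joinD, Function.update_comm hkj]
      first
      | exact max_le_max (sub_nonneg.1 (hk _)) (sub_nonneg.1 (hk _))
      | exact max_le_max (sub_nonpos.1 (hk _)) (sub_nonpos.1 (hk _))

theorem stmt12 {n : ℕ} (f : (Fin n → Bool) → ℝ) (h : IsMonotoneFn f) (j : Fin n) :
    IsMonotoneFn (meetD f j) ∧ IsMonotoneFn (joinD f j) :=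
  ⟨h.meetD j, h.joinD j⟩
end

section
/- If a pseudo-Boolean function f : B^n → ℝ is p-locally monotone with p ≥ 2, then ∧_j f and ∨_j f are (p−1)-locally monotone for every j ∈ [n]. -/
open Finset

/-- Reals with pairwise nonnegative products have a common sign. -/
theorem forall_nonneg_or_forall_nonpos {α : Type*} (u : α → ℝ)
    (h : ∀ i j, 0 ≤ u i * u j) : (∀ i, 0 ≤ u i) ∨ (∀ i, u i ≤ 0) := by
  by_cases hpos : ∃ i, 0 < u i
  · obtain ⟨i, hi⟩ := hpos
    exact Or.inl fun j => nonneg_of_mul_nonneg_right (h i j) hi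
  · exact Or.inr fun j => not_lt.mp fun hj => hpos ⟨j, hj⟩

/-- Fixing a common coordinate to arbitrary values adds at most one position where two tuples
differ. -/
theorem card_filter_update_ne_le {n : ℕ} (k j : Fin n) (x y : Fin n → Bool) (a b : Bool) :
    (univ.filter fun i =>
      i ≠ k ∧ Function.update x j a i ≠ Function.update y j b i).card ≤
      (univ.filter fun i => i ≠ k ∧ x i ≠ y i).card + 1 := by
  refine le_trans (card_le_card fun i hi => ?_) (card_insert_le j _)
  by_cases hij : i = j
  · simp [hij]
  · simpa [hij] using hi

/-- If all partial derivatives of `f` at tuples obtained from `x` and `y` by fixing the `j`-th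
coordinate have pairwise compatible signs, then so do the partial derivatives at `x` and `y` of
`op (f x_j^0) (f x_j^1)`, for any monotone binary operation `op`. -/
theorem pderiv_op_mul_nonneg {ι : Type*} [DecidableEq ι] (op : ℝ → ℝ → ℝ)
    (hop : ∀ a b c d, a ≤ c → b ≤ d → op a b ≤ op c d)
    (f : (ι → Bool) → ℝ) {k j : ι} (hkj : k ≠ j) (z : Bool → ι → Bool)
    (h : ∀ s t a b, 0 ≤ pderiv f k (Function.update (z s) j a) *
      pderiv f k (Function.update (z t) j b)) (s t : Bool) :
    0 ≤ pderiv (fun x => op (f (Function.update x j false)) (f (Function.update x j true)))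
        k (z s) *
      pderiv (fun x => op (f (Function.update x j false)) (f (Function.update x j true)))
        k (z t) := by
  rcases forall_nonneg_or_forall_nonpos
    (fun i : Bool × Bool => pderiv f k (Function.update (z i.1) j i.2))
    (fun i i' => h i.1 i'.1 i.2 i'.2) with hs | hs
  · have key (s : Bool) : 0 ≤ pderiv
        (fun x => op (f (Function.update x j false)) (f (Function.update x j true))) k (z s) := by
      have h0 := hs (s, false)
      have h1 := hs (s, true)
      simp only [pderiv, sub_nonneg, Function.update_comm hkj.symm] at h0 h1 ⊢
      exact hop _ _ _ _ h0 h1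
    exact mul_nonneg (key s) (key t)
  · have key (s : Bool) : pderiv
        (fun x => op (f (Function.update x j false)) (f (Function.update x j true))) k (z s)
          ≤ 0 := by
      have h0 := hs (s, false)
      have h1 := hs (s, true)
      simp only [pderiv, sub_nonpos, Function.update_comm hkj.symm] at h0 h1 ⊢
      exact hop _ _ _ _ h0 h1
    exact mul_nonneg_of_nonpos_of_nonpos (key s) (key t)

/-- Combining the two values of a `p`-locally monotone function along one coordinate by a monotone
binary operation gives a `(p - 1)`-locally monotone function. -/
theorem LocallyMonotone.op {n p : ℕ} {f : (Fin n → Bool) → ℝ} (h : LocallyMonotone p f)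
    (hp : 2 ≤ p) (j : Fin n) (op : ℝ → ℝ → ℝ)
    (hop : ∀ a b c d, a ≤ c → b ≤ d → op a b ≤ op c d) :
    LocallyMonotone (p - 1)
      (fun x => op (f (Function.update x j false)) (f (Function.update x j true))) := by
  intro k x y hxy
  by_cases hkj : k = j
  · simp [hkj, pderiv]
  have hyx : (univ.filter fun i => i ≠ k ∧ y i ≠ x i).card < p - 1 := by
    simpa only [ne_comm] using hxy
  have hself (w : Fin n → Bool) : (univ.filter fun i => i ≠ k ∧ w i ≠ w i).card < p - 1 := by
    simp only [ne_eq, not_true_eq_false, and_false, filter_false, card_empty]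
    omega
  have hlift {v w : Fin n → Bool}
      (hvw : (univ.filter fun i => i ≠ k ∧ v i ≠ w i).card < p - 1) (a b : Bool) :
      0 ≤ pderiv f k (Function.update v j a) * pderiv f k (Function.update w j b) :=
    h k _ _ (by have := card_filter_update_ne_le k j v w a b; omega)
  refine pderiv_op_mul_nonneg op hop f hkj (fun s => cond s x y) ?_ true false
  rintro (_ | _) (_ | _)
  exacts [hlift (hself y), hlift hyx, hlift hxy, hlift (hself x)]

theorem stmt13 {n : ℕ} (p : ℕ) (hp : 2 ≤ p) (hpn : p ≤ n) (f : (Fin n → Bool) → ℝ)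
    (h : LocallyMonotone p f) (j : Fin n) :
    LocallyMonotone (p - 1) (meetD f j) ∧ LocallyMonotone (p - 1) (joinD f j) := by
  exact ⟨h.op hp j min fun _ _ _ _ => min_le_min, h.op hp j max fun _ _ _ _ => max_le_max⟩
end

section
/- Let 0 ≤ ℓ < p ≤ n. If a pseudo-Boolean function f : B^n → ℝ is p-locally monotone, then for every ℓ-element subset {k_1,...,k_ℓ} ⊆ [n] and every choice of operators O_{k_i} ∈ {∨_{k_i}, ∧_{k_i}} (i = 1,...,ℓ), the function O_{k_1}···O_{k_ℓ} f is (p−ℓ)-locally monotone. -/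
open Finset

theorem pderiv_latD_self {ι : Type*} [DecidableEq ι] (o : Bool) (f : (ι → Bool) → ℝ) (k : ι)
    (x : ι → Bool) : pderiv (latD (o, k) f) k x = 0 := by
  cases o <;> simp [pderiv, latD, joinD, meetD]

/-- If a partial derivative of a lattice derivative is positive at `x`, the corresponding partial
derivative of the function is positive at `x` or at its neighbour in direction `j`. -/
theorem exists_pderiv_pos_of_pderiv_latD_pos {ι : Type*} [DecidableEq ι] {o : Bool}
    {f : (ι → Bool) → ℝ} {j k : ι} (hjk : j ≠ k) {x : ι → Bool}
    (h : 0 < pderiv (latD (o, j) f) k x) : ∃ a, 0 < pderiv f k (Function.update x j a) := by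
  by_contra! hc
  have h0 := hc false
  have h1 := hc true
  cases o <;>
  · simp only [pderiv, latD, joinD, meetD, Function.update_comm hjk.symm, if_true,
      Bool.false_eq_true, if_false] at h h0 h1
    grind

theorem exists_pderiv_neg_of_pderiv_latD_neg {ι : Type*} [DecidableEq ι] {o : Bool}
    {f : (ι → Bool) → ℝ} {j k : ι} (hjk : j ≠ k) {x : ι → Bool}
    (h : pderiv (latD (o, j) f) k x < 0) : ∃ a, pderiv f k (Function.update x j a) < 0 := by
  by_contra! hc
  have h0 := hc false
  have h1 := hc true
  cases o <;>
  · simp only [pderiv, latD, joinD, meetD, Function.update_comm hjk.symm, if_true,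
      Bool.false_eq_true, if_false] at h h0 h1
    grind

theorem LocallyMonotone.latD {n p : ℕ} {f : (Fin n → Bool) → ℝ} (h : LocallyMonotone (p + 1) f)
    (ok : Bool × Fin n) : LocallyMonotone p (latD ok f) := by
  obtain ⟨o, j⟩ := ok
  intro k x y hxy
  obtain rfl | hjk := eq_or_ne j k
  · simp [pderiv_latD_self]
  have key (a b : Bool) :
      0 ≤ pderiv f k (Function.update x j a) * pderiv f k (Function.update y j b) := by
    refine h k _ _ (lt_of_le_of_lt ?_ (Nat.succ_lt_succ hxy))
    refine (Finset.card_le_card (t := insert j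
      (Finset.univ.filter (fun i => i ≠ k ∧ x i ≠ y i))) ?_).trans (Finset.card_insert_le _ _)
    intro i hi
    by_cases hij : i = j
    · simp [hij]
    · simpa [hij] using hi
  by_contra! hc
  rcases mul_neg_iff.1 hc with ⟨hx, hy⟩ | ⟨hx, hy⟩
  · obtain ⟨a, ha⟩ := exists_pderiv_pos_of_pderiv_latD_pos hjk hx
    obtain ⟨b, hb⟩ := exists_pderiv_neg_of_pderiv_latD_neg hjk hy
    exact (mul_neg_of_pos_of_neg ha hb).not_ge (key a b)
  · obtain ⟨a, ha⟩ := exists_pderiv_neg_of_pderiv_latD_neg hjk hx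
    obtain ⟨b, hb⟩ := exists_pderiv_pos_of_pderiv_latD_pos hjk hy
    exact (mul_neg_of_neg_of_pos ha hb).not_ge (key a b)

theorem LocallyMonotone.applyOps {n : ℕ} {f : (Fin n → Bool) → ℝ} (ops : List (Bool × Fin n))
    {p : ℕ} (h : LocallyMonotone (p + ops.length) f) : LocallyMonotone p (applyOps ops f) := by
  induction ops generalizing p with
  | nil => exact h
  | cons a t ih =>
    refine LocallyMonotone.latD (ih ?_) a
    rwa [List.length_cons, Nat.add_comm t.length, ← Nat.add_assoc] at h

theorem stmt14 {n : ℕ} (l p : ℕ) (hlp : l < p) (hpn : p ≤ n) (f : (Fin n → Bool) → ℝ)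
    (h : LocallyMonotone p f) :
    ∀ ops : List (Bool × Fin n), ops.length = l → (ops.map Prod.snd).Nodup →
      LocallyMonotone (p - l) (applyOps ops f) := by
  intro ops hl _
  apply LocallyMonotone.applyOps
  rwa [hl, Nat.sub_add_cancel hlp.le]
end

section
/- Let f, g : B^n → ℝ be pseudo-Boolean functions such that ∨_k f = ∨_k g and ∧_k f = ∧_k g for all k ∈ [n]. Then either f = g, or there exists an injective function α : B → ℝ such that f(x) = α(x_1 ⊕ ··· ⊕ x_n) and g(x) = α(x_1 ⊕ ··· ⊕ x_n ⊕ 1) for all x ∈ B^n. -/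
open Finset

/-- The parity `x_1 ⊕ ⋯ ⊕ x_n`. -/
def parity {n : ℕ} (x : Fin n → Bool) : Bool :=
  decide ((Finset.univ.filter fun i => x i = true).card % 2 = 1)

theorem parity_update_true {n : ℕ} (x : Fin n → Bool) (k : Fin n) :
    parity (Function.update x k true) = !parity (Function.update x k false) := by
  have hs : (univ.filter fun i => Function.update x k true i = true) =
      insert k (univ.filter fun i => Function.update x k false i = true) := by
    ext i
    by_cases hi : i = k
    · subst hi; simp
    · simp [hi]
  have hk : k ∉ univ.filter fun i => Function.update x k false i = true := by simp
  rw [parity, parity, hs, card_insert_of_notMem hk, ← decide_not, decide_eq_decide]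
  omega

theorem eq_and_eq_or_eq_and_eq_of_max_of_min {a b c d : ℝ}
    (hmax : max a b = max c d) (hmin : min a b = min c d) :
    (a = c ∧ b = d) ∨ (a = d ∧ b = c) := by
  grind

/-- Any two points of the cube are connected by changing one coordinate at a time. -/
theorem cube_induction {ι : Type*} [Fintype ι] [DecidableEq ι] {P : (ι → Bool) → Prop}
    (a : ι → Bool) (ha : P a) (hP : ∀ x k b, P x → P (Function.update x k b))
    (x : ι → Bool) : P x := by
  have hs (s : Finset ι) : P (s.piecewise x a) := by
    induction s using Finset.induction_on with
    | empty => simpa using ha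
    | insert j s _ ih => rw [piecewise_insert]; exact hP _ _ _ ih
  simpa using hs univ

theorem stmt16 {n : ℕ} (f g : (Fin n → Bool) → ℝ)
    (h : ∀ k : Fin n, joinD f k = joinD g k ∧ meetD f k = meetD g k) :
    f = g ∨ ∃ α : Bool → ℝ, Function.Injective α ∧
      ∀ x, f x = α (parity x) ∧ g x = α (!(parity x)) := by
  rw [or_iff_not_imp_left]
  intro hne
  obtain ⟨a, ha⟩ := Function.ne_iff.mp hne
  set α : Bool → ℝ := fun b => if b = parity a then f a else g a with hα
  have hinj : α false ≠ α true := by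
    cases hp : parity a <;> simp [hα, hp, ha, ha.symm]
  refine ⟨α, Bool.injective_iff.mpr hinj, cube_induction a (by simp [hα]) ?_⟩
  intro x k b hx
  have hpar := parity_update_true x k
  have hswap := eq_and_eq_or_eq_and_eq_of_max_of_min
    (congrFun (h k).1 x) (congrFun (h k).2 x)
  have hxk : Function.update x k (x k) = x := Function.update_eq_self k x
  clear_value α
  cases hxv : x k <;> cases b <;> rw [hxv] at hxk <;> rw [hxk] at hpar hswap <;>
    cases hp : parity x <;> grind
end

section
/- If a pseudo-Boolean function f : B^n → ℝ has (p+1)-permutable lattice derivatives (where p+1 ≤ n), then f has p-permutable lattice derivatives. -/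
open Finset

theorem latD_mono {ι : Type*} [DecidableEq ι] (o : Bool × ι) : Monotone (latD o) := by
  intro g h hgh x
  rcases o with ⟨b, k⟩
  cases b
  · exact min_le_min (hgh _) (hgh _)
  · exact max_le_max (hgh _) (hgh _)

theorem applyOps_mono {ι : Type*} [DecidableEq ι] (l : List (Bool × ι)) :
    Monotone (applyOps l) := by
  induction l with
  | nil => exact monotone_id
  | cons o l ih => exact (latD_mono o).comp ih

theorem applyOps_append {ι : Type*} [DecidableEq ι] (l₁ l₂ : List (Bool × ι))
    (f : (ι → Bool) → ℝ) : applyOps (l₁ ++ l₂) f = applyOps l₁ (applyOps l₂ f) :=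
  List.foldr_append

/-- Two lattice derivatives in distinct variables, applied in either order, give comparable
functions: this is the inequality `max min ≤ min max`. -/
theorem latD_latD_le_or_ge {ι : Type*} [DecidableEq ι] (o o' : Bool × ι) (hne : o.2 ≠ o'.2)
    (g : (ι → Bool) → ℝ) :
    latD o (latD o' g) ≤ latD o' (latD o g) ∨ latD o' (latD o g) ≤ latD o (latD o' g) := by
  rcases o with ⟨b, j⟩
  rcases o' with ⟨b', k⟩
  have hcomm : ∀ (x : ι → Bool) (c d : Bool), Function.update (Function.update x k c) j d =
      Function.update (Function.update x j d) k c := fun x c d =>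
    Function.update_comm (Ne.symm hne) c d x
  cases b <;> cases b'
  · left
    intro x
    simp only [latD, meetD, hcomm, Bool.false_eq_true, if_false]
    exact (inf_inf_inf_comm _ _ _ _).le
  · right
    intro x
    simp only [latD, meetD, joinD, hcomm, Bool.false_eq_true, if_false, if_true]
    exact max_le (min_le_min (le_max_left _ _) (le_max_left _ _))
      (min_le_min (le_max_right _ _) (le_max_right _ _))
  · left
    intro x
    simp only [latD, meetD, joinD, hcomm, Bool.false_eq_true, if_false, if_true]
    exact max_le (min_le_min (le_max_left _ _) (le_max_left _ _))
      (min_le_min (le_max_right _ _) (le_max_right _ _))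
  · left
    intro x
    simp only [latD, joinD, hcomm, if_true]
    exact (sup_sup_sup_comm _ _ _ _).le

/-- Comparable functions with the same meet and join derivatives in one variable are equal. -/
theorem eq_of_le_of_latD_eq {ι : Type*} [DecidableEq ι] {g h : (ι → Bool) → ℝ} (m : ι)
    (hgh : g ≤ h) (heq : ∀ b, latD (b, m) g = latD (b, m) h) : g = h := by
  have key : ∀ x, g (Function.update x m false) = h (Function.update x m false) ∧
      g (Function.update x m true) = h (Function.update x m true) := by
    intro x
    have hmin : min (g (Function.update x m false)) (g (Function.update x m true)) =
        min (h (Function.update x m false)) (h (Function.update x m true)) :=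
      congrFun (heq false) x
    have hmax : max (g (Function.update x m false)) (g (Function.update x m true)) =
        max (h (Function.update x m false)) (h (Function.update x m true)) :=
      congrFun (heq true) x
    have h₀ := hgh (Function.update x m false)
    have h₁ := hgh (Function.update x m true)
    have hg := min_add_max (g (Function.update x m false)) (g (Function.update x m true))
    have hh := min_add_max (h (Function.update x m false)) (h (Function.update x m true))
    constructor <;> linarith
  funext x
  cases hx : x m
  · simpa [← hx] using (key x).1
  · simpa [← hx] using (key x).2

/-- Permutability follows from invariance under transpositions of adjacent operators. -/
theorem permutable_of_swap {ι : Type*} [DecidableEq ι] {p : ℕ} {f : (ι → Bool) → ℝ}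
    (hswap : ∀ (l₁ l₂ : List (Bool × ι)) (o o' : Bool × ι),
      (l₁ ++ o :: o' :: l₂).length = p → ((l₁ ++ o :: o' :: l₂).map Prod.snd).Nodup →
      applyOps (l₁ ++ o :: o' :: l₂) f = applyOps (l₁ ++ o' :: o :: l₂) f) :
    Permutable p f := by
  suffices H : ∀ l l' : List (Bool × ι), l.Perm l' → ∀ l₁ : List (Bool × ι),
      (l₁ ++ l).length = p → ((l₁ ++ l).map Prod.snd).Nodup →
      applyOps (l₁ ++ l) f = applyOps (l₁ ++ l') f from
    fun l l' hlen hnd hperm => H l l' hperm [] hlen hnd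
  intro l l' hperm
  induction hperm with
  | nil => intros; rfl
  | cons o _ ih =>
    intro l₁ hlen hnd
    have := ih (l₁ ++ [o])
    simp only [List.append_assoc, List.singleton_append] at this
    exact this hlen hnd
  | swap o o' l => exact fun l₁ hlen hnd => hswap l₁ l o' o hlen hnd
  | trans h₁ _ ih₁ ih₂ =>
    intro l₁ hlen hnd
    have hp := h₁.append_left l₁
    exact (ih₁ l₁ hlen hnd).trans
      (ih₂ l₁ (hp.length_eq ▸ hlen) ((hp.map Prod.snd).nodup_iff.1 hnd))

theorem stmt17 {n : ℕ} (p : ℕ) (hp : 1 ≤ p) (hpn : p + 1 ≤ n) (f : (Fin n → Bool) → ℝ)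
    (h : Permutable (p + 1) f) : Permutable p f := by
  refine permutable_of_swap fun l₁ l₂ o o' hlen hnd => ?_
  obtain ⟨m, hm⟩ : ∃ m, m ∉ (l₁ ++ o :: o' :: l₂).map Prod.snd := by
    by_contra! hall
    have hcard : n ≤ ((l₁ ++ o :: o' :: l₂).map Prod.snd).toFinset.card := by
      rw [Finset.eq_univ_of_forall fun m => List.mem_toFinset.2 (hall m), Finset.card_fin]
    have := hcard.trans (List.toFinset_card_le _)
    rw [List.length_map] at this
    omega
  have heq : ∀ b, latD (b, m) (applyOps (l₁ ++ o :: o' :: l₂) f) =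
      latD (b, m) (applyOps (l₁ ++ o' :: o :: l₂) f) := fun b =>
    h ((b, m) :: (l₁ ++ o :: o' :: l₂)) ((b, m) :: (l₁ ++ o' :: o :: l₂))
      (congrArg Nat.succ hlen) (List.nodup_cons.2 ⟨hm, hnd⟩)
      (((List.Perm.swap o' o l₂).append_left l₁).cons _)
  have hne : o.2 ≠ o'.2 := by
    rw [List.map_append] at hnd
    have := hnd.of_append_right
    simp only [List.map_cons, List.nodup_cons, List.mem_cons, not_or] at this
    exact this.1.1
  simp only [applyOps_append] at heq ⊢
  rcases latD_latD_le_or_ge o o' hne (applyOps l₂ f) with hle | hle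
  · exact eq_of_le_of_latD_eq m (applyOps_mono l₁ hle) heq
  · exact (eq_of_le_of_latD_eq m (applyOps_mono l₁ hle) fun b => (heq b).symm).symm
end

section
/- Let f : B^n → ℝ be a symmetric pseudo-Boolean function corresponding to the sequence α_0, α_1, ..., α_n (so that f(x) = α_{|x|}). Then f is p-locally monotone if and only if every subsequence of p+1 consecutive entries α_i, α_{i+1}, ..., α_{i+p} (0 ≤ i ≤ n−p) is either nondecreasing or nonincreasing. -/
open Finset

/-- The partial derivative of a symmetric function is a first difference of its sequence. -/
theorem pderiv_symmetric {ι : Type*} [Fintype ι] [DecidableEq ι] {α : ℕ → ℝ}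
    {f : (ι → Bool) → ℝ} (hf : ∀ x, f x = α (univ.filter (fun i => x i = true)).card)
    (k : ι) (x : ι → Bool) :
    pderiv f k x = α ((univ.filter (fun i => i ≠ k ∧ x i = true)).card + 1) -
      α (univ.filter (fun i => i ≠ k ∧ x i = true)).card := by
  have h1 : univ.filter (fun i => Function.update x k true i = true) =
      insert k (univ.filter (fun i => i ≠ k ∧ x i = true)) := by
    ext i
    by_cases h : i = k <;> simp [Function.update_apply, h]
  have h0 : univ.filter (fun i => Function.update x k false i = true) =
      univ.filter (fun i => i ≠ k ∧ x i = true) := by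
    ext i
    by_cases h : i = k <;> simp [Function.update_apply, h]
  rw [pderiv, hf, hf, h1, h0, card_insert_of_notMem (by simp)]

theorem card_filter_true_le_add {ι : Type*} [Fintype ι] [DecidableEq ι] (k : ι)
    (x y : ι → Bool) :
    (univ.filter (fun i => i ≠ k ∧ x i = true)).card ≤
      (univ.filter (fun i => i ≠ k ∧ y i = true)).card +
        (univ.filter (fun i => i ≠ k ∧ x i ≠ y i)).card := by
  refine (card_le_card fun i hi => ?_).trans (card_union_le _ _)
  simp only [mem_union, mem_filter, mem_univ, true_and] at hi ⊢
  by_cases h : y i = true <;> simp_all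

theorem card_filter_ne_and_true_lt {n : ℕ} (k : Fin n) (x : Fin n → Bool) :
    (univ.filter (fun i => i ≠ k ∧ x i = true)).card < n := by
  have h : univ.filter (fun i => i ≠ k ∧ x i = true) ⊂ univ :=
    (ssubset_univ_iff).2 fun h => by simpa using h.ge (mem_univ k)
  simpa using card_lt_card h

theorem Fin.card_filter_val_mem_Ico {n a b : ℕ} (hb : b ≤ n) :
    (univ.filter (fun i : Fin n => a ≤ i.val ∧ i.val < b)).card = b - a := by
  rw [← Nat.card_Ico, ← card_map Fin.valEmbedding]
  congr 1
  ext m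
  simp only [mem_map, mem_filter, mem_univ, true_and, Fin.valEmbedding_apply, mem_Ico]
  exact ⟨by rintro ⟨i, hi, rfl⟩; exact hi, fun h => ⟨⟨m, by omega⟩, h, rfl⟩⟩

/-- Differences of a locally monotone symmetric function at nearby levels do not have
opposite signs. -/
theorem LocallyMonotone.mul_sub_nonneg {n p : ℕ} {α : ℕ → ℝ} {f : (Fin n → Bool) → ℝ}
    (hf : ∀ x, f x = α (univ.filter (fun i => x i = true)).card)
    (h : LocallyMonotone p f) {a b : ℕ} (hab : a ≤ b) (hb : b < n) (hp : b - a < p) :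
    0 ≤ (α (a + 1) - α a) * (α (b + 1) - α b) := by
  have hlt : n - 1 < n := by omega
  have hcard (c : ℕ) (hc : c < n) : (univ.filter (fun i : Fin n =>
      i ≠ ⟨n - 1, hlt⟩ ∧ decide (i.val < c) = true)).card = c := by
    rw [filter_congr (q := fun i : Fin n => 0 ≤ i.val ∧ i.val < c),
      Fin.card_filter_val_mem_Ico hc.le, Nat.sub_zero]
    intro i _
    simp only [ne_eq, Fin.ext_iff, decide_eq_true_eq]
    omega
  have key := h ⟨n - 1, hlt⟩ (fun i => decide (i.val < a)) (fun i => decide (i.val < b)) (by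
    refine lt_of_le_of_lt ?_ hp
    rw [← Fin.card_filter_val_mem_Ico hb.le]
    refine card_le_card fun i hi => ?_
    simp only [mem_filter, mem_univ, true_and, ne_eq, decide_eq_decide] at hi ⊢
    omega)
  rwa [pderiv_symmetric hf, pderiv_symmetric hf, hcard a (by omega), hcard b hb] at key

theorem stmt18 {n : ℕ} (p : ℕ) (hp : 1 ≤ p) (hpn : p ≤ n) (α : ℕ → ℝ)
    (f : (Fin n → Bool) → ℝ)
    (hf : ∀ x, f x = α (Finset.univ.filter (fun i => x i = true)).card) :
    LocallyMonotone p f ↔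
      ∀ i : ℕ, i + p ≤ n →
        ((∀ j < p, α (i + j) ≤ α (i + j + 1)) ∨
         (∀ j < p, α (i + j + 1) ≤ α (i + j))) := by
  constructor
  · intro h i hi
    by_contra! hcon
    obtain ⟨⟨j, hj, hj'⟩, l, hl, hl'⟩ := hcon
    have hneg := mul_neg_of_neg_of_pos (sub_neg.2 hj') (sub_pos.2 hl')
    rcases le_total j l with hjl | hjl
    · exact hneg.not_ge (h.mul_sub_nonneg hf (by omega) (by omega) (by omega))
    · rw [mul_comm] at hneg
      exact hneg.not_ge (h.mul_sub_nonneg hf (by omega) (by omega) (by omega))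
  · intro h k x y hxy
    have hxy' := card_filter_true_le_add k x y
    have hyx := card_filter_true_le_add k y x
    simp only [ne_comm (a := y _)] at hyx
    have hx := card_filter_ne_and_true_lt k x
    have hy := card_filter_ne_and_true_lt k y
    rw [pderiv_symmetric hf, pderiv_symmetric hf]
    generalize (univ.filter (fun i => i ≠ k ∧ x i = true)).card = a at *
    generalize (univ.filter (fun i => i ≠ k ∧ y i = true)).card = b at *
    obtain ⟨i, hi, hia, hap, hib, hbp⟩ :
        ∃ i, i + p ≤ n ∧ i ≤ a ∧ a - i < p ∧ i ≤ b ∧ b - i < p :=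
      ⟨min (min a b) (n - p), by omega, by omega, by omega, by omega, by omega⟩
    rcases h i hi with h | h
    · have ha := h _ hap
      have hb := h _ hbp
      rw [Nat.add_sub_cancel' hia] at ha
      rw [Nat.add_sub_cancel' hib] at hb
      exact mul_nonneg (sub_nonneg.2 ha) (sub_nonneg.2 hb)
    · have ha := h _ hap
      have hb := h _ hbp
      rw [Nat.add_sub_cancel' hia] at ha
      rw [Nat.add_sub_cancel' hib] at hb
      exact mul_nonneg_of_nonpos_of_nonpos (sub_nonpos.2 ha) (sub_nonpos.2 hb)
end

section
/- A symmetric pseudo-Boolean function f : B^n → ℝ is p-locally monotone if and only if f has p-permutable lattice derivatives. -/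
open Finset

/-- The meet (`false`) or join (`true`) of consecutive terms of a sequence: the action of a
lattice derivative on the weight profile of a symmetric function. -/
def seqOp (b : Bool) (c : ℕ → ℝ) (i : ℕ) : ℝ :=
  if b then max (c i) (c (i + 1)) else min (c i) (c (i + 1))

/-- Composition of the operators `seqOp` listed in `l`. -/
def seqOps (l : List Bool) (c : ℕ → ℝ) : ℕ → ℝ := l.foldr seqOp c

/-- Increments of `c` at distance less than `p` never have opposite signs. -/
def SeqLocallyMonotone (p : ℕ) (c : ℕ → ℝ) : Prop :=
  ∀ i j, i < j + p → j < i + p → c i < c (i + 1) → c j ≤ c (j + 1)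

/-- The words of length `p` in `seqOp` act on `c 0, …, c n` up to permutation of the letters. -/
def SeqPermutable (n p : ℕ) (c : ℕ → ℝ) : Prop :=
  ∀ l l' : List Bool, l.Perm l' → l.length = p → ∀ i, i + p ≤ n → seqOps l c i = seqOps l' c i

theorem seqOps_cons (b : Bool) (l : List Bool) (c : ℕ → ℝ) :
    seqOps (b :: l) c = seqOp b (seqOps l c) := rfl

theorem seqOps_append (l l' : List Bool) (c : ℕ → ℝ) :
    seqOps (l ++ l') c = seqOps l (seqOps l' c) := by
  simp [seqOps]

theorem seqOp_mono (b : Bool) {c d : ℕ → ℝ} (h : c ≤ d) : seqOp b c ≤ seqOp b d := by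
  intro i
  cases b
  · exact min_le_min (h i) (h (i + 1))
  · exact max_le_max (h i) (h (i + 1))

theorem seqOps_mono (l : List Bool) {c d : ℕ → ℝ} (h : c ≤ d) : seqOps l c ≤ seqOps l d := by
  induction l with
  | nil => exact h
  | cons b l ih => exact seqOp_mono b ih

theorem seqOp_neg (b : Bool) (c : ℕ → ℝ) : seqOp b (-c) = -seqOp (!b) c := by
  funext i
  cases b
  · simp [seqOp, min_neg_neg]
  · simp [seqOp, max_neg_neg]

theorem seqOps_neg (l : List Bool) (c : ℕ → ℝ) : seqOps l (-c) = -seqOps (l.map not) c := by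
  induction l with
  | nil => rfl
  | cons b l ih => rw [seqOps_cons, ih, seqOp_neg, List.map_cons, seqOps_cons]

theorem SeqPermutable.neg {n p : ℕ} {c : ℕ → ℝ} (h : SeqPermutable n p c) :
    SeqPermutable n p (-c) := by
  intro l l' hl hp i hi
  rw [seqOps_neg, seqOps_neg, Pi.neg_apply, Pi.neg_apply,
    h _ _ (hl.map not) (by simpa using hp) i hi]

theorem SeqLocallyMonotone.seqOp {p : ℕ} {c : ℕ → ℝ} (h : SeqLocallyMonotone (p + 1) c)
    (b : Bool) : SeqLocallyMonotone p (seqOp b c) := by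
  intro i j hij hji hi
  by_contra! hj
  have h1 := h i j (by omega) (by omega)
  have h2 := h i (j + 1) (by omega) (by omega)
  have h3 := h (i + 1) j (by omega) (by omega)
  have h4 := h (i + 1) (j + 1) (by omega) (by omega)
  cases b <;> simp [_root_.seqOp] at hi hj <;> grind

theorem SeqLocallyMonotone.seqOps {p q : ℕ} {c : ℕ → ℝ} (h : SeqLocallyMonotone p c)
    (l : List Bool) (hl : q + l.length = p) : SeqLocallyMonotone q (seqOps l c) := by
  induction l generalizing q with
  | nil => exact (show q = p from hl) ▸ h
  | cons b l ih => exact (ih (q := q + 1) (by rw [List.length_cons] at hl; omega)).seqOp b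

theorem SeqLocallyMonotone.seqOp_comm {c : ℕ → ℝ} (h : SeqLocallyMonotone 2 c) (a b : Bool) :
    _root_.seqOp a (_root_.seqOp b c) = _root_.seqOp b (_root_.seqOp a c) := by
  funext i
  have h1 := h i (i + 1) (by omega) (by omega)
  have h2 := h (i + 1) i (by omega) (by omega)
  cases a <;> cases b <;> simp [_root_.seqOp] <;> grind

theorem SeqLocallyMonotone.seqOps_perm {p : ℕ} {c : ℕ → ℝ} (h : SeqLocallyMonotone p c)
    {l l' : List Bool} (hl : l.Perm l') (hp : l.length ≤ p) :
    _root_.seqOps l c = _root_.seqOps l' c := by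
  induction hl with
  | nil => rfl
  | cons b _ ih =>
    rw [List.length_cons] at hp
    rw [seqOps_cons, seqOps_cons, ih (by omega)]
  | swap a b l =>
    simp only [List.length_cons] at hp
    simp only [seqOps_cons]
    have h2 := h.seqOps (q := p - l.length) l (by omega)
    exact SeqLocallyMonotone.seqOp_comm (fun i j hi hj => h2 i j (by omega) (by omega)) b a
  | trans h₁ _ ih₁ ih₂ => rw [ih₁ hp, ih₂ (by rwa [← h₁.length_eq])]

theorem seqOps_join_meet_le (r : ℕ) (c : ℕ → ℝ) :
    seqOps (true :: List.replicate r false) c ≤ seqOps (List.replicate r false ++ [true]) c := by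
  induction r with
  | zero => exact le_rfl
  | succ r ih =>
    refine le_trans (fun i => ?_) (seqOp_mono false ih)
    simp only [List.replicate_succ, seqOps_cons]
    generalize seqOps _ c = d
    simp only [seqOp]
    grind

theorem seqOps_meet_le (r : ℕ) (c : ℕ → ℝ) (i l : ℕ) (hi : i ≤ l) (hl : l ≤ i + r) :
    seqOps (List.replicate r false) c i ≤ c l := by
  induction r generalizing i with
  | zero => obtain rfl : l = i := by omega
            exact le_rfl
  | succ r ih =>
    rw [List.replicate_succ, seqOps_cons]
    rcases Nat.lt_or_ge (i + r) l with h | h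
    · exact (min_le_right _ _).trans (ih (i + 1) (by omega) (by omega))
    · exact (min_le_left _ _).trans (ih i hi h)

theorem le_seqOps_meet (r : ℕ) (c : ℕ → ℝ) (i : ℕ) (t : ℝ)
    (h : ∀ l, i ≤ l → l ≤ i + r → t ≤ c l) : t ≤ seqOps (List.replicate r false) c i := by
  induction r generalizing i with
  | zero => exact h i le_rfl le_rfl
  | succ r ih =>
    rw [List.replicate_succ, seqOps_cons]
    exact le_min (ih i fun l h1 h2 => h l h1 (by omega))
      (ih (i + 1) fun l h1 h2 => h l (by omega) (by omega))

/-- Comparable sequences are equal on an initial segment as soon as all words of a given length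
identify them there. -/
theorem eq_of_seqOps_eq {g h : ℕ → ℝ} (hgh : g ≤ h) (k N : ℕ)
    (H : ∀ U : List Bool, U.length = k → ∀ i, i ≤ N → seqOps U g i = seqOps U h i) :
    ∀ i, i ≤ N + k → g i = h i := by
  induction k generalizing N with
  | zero => exact H [] rfl
  | succ k ih =>
    have key : ∀ U : List Bool, U.length = k → ∀ i, i ≤ N →
        seqOps U g i = seqOps U h i ∧ seqOps U g (i + 1) = seqOps U h (i + 1) := by
      intro U hU i hi
      have h1 := H (true :: U) (by simp [hU]) i hi
      have h2 := H (false :: U) (by simp [hU]) i hi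
      have h3 := seqOps_mono U hgh i
      have h4 := seqOps_mono U hgh (i + 1)
      simp only [seqOps_cons, seqOp] at h1 h2
      grind
    intro i hi
    refine ih (N + 1) (fun U hU j hj => ?_) i (by omega)
    rcases Nat.lt_or_ge N j with hj' | hj'
    · obtain rfl : j = N + 1 := by omega
      exact (key U hU N le_rfl).2
    · exact (key U hU j hj').1

theorem SeqPermutable.not_peak {n p : ℕ} {c : ℕ → ℝ} (h : SeqPermutable n p c) (r i : ℕ)
    (hr : r < p) (hi : i + r + 1 ≤ n) (hpn : p ≤ n)
    (h1 : c i < c (i + 1)) : c (i + r) ≤ c (i + r + 1) := by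
  induction r using Nat.strong_induction_on generalizing i with
  | _ r ih =>
  by_contra! h2
  have flat : ∀ s, s < r → c (i + 1 + s) = c (i + 1) := by
    intro s hs
    induction s with
    | zero => rfl
    | succ s ihs =>
      rw [← ihs (by omega)]
      apply le_antisymm
      · by_contra! h3
        have := ih (r - (1 + s)) (by omega) (i + 1 + s) (by omega) (by omega) h3
        rw [show i + 1 + s + (r - (1 + s)) = i + r by omega] at this
        exact absurd this (not_le.mpr h2)
      · have := ih (1 + s) (by omega) i (by omega) (by omega) h1
        rwa [show i + (1 + s) = i + 1 + s by omega] at this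
  have hr0 : 0 < r := by
    rcases Nat.eq_zero_or_pos r with rfl | h0
    · exact absurd h1 (not_lt.mpr h2.le)
    · exact h0
  have hle := seqOps_join_meet_le r c
  have heq := eq_of_seqOps_eq hle (p - (r + 1)) (n - p) (fun U hU j hj => by
    rw [← seqOps_append, ← seqOps_append]
    refine h _ _ (List.Perm.append_left U ?_) (by simp [hU]; omega) j (by omega)
    exact (List.perm_append_singleton _ _).symm) i (by omega)
  have hlow : seqOps (true :: List.replicate r false) c i < c (i + 1) := by
    rw [seqOps_cons]
    refine max_lt ((seqOps_meet_le r c i i le_rfl (by omega)).trans_lt h1)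
      ((seqOps_meet_le r c (i + 1) (i + r + 1) (by omega) (by omega)).trans_lt ?_)
    have := flat (r - 1) (by omega)
    rw [show i + 1 + (r - 1) = i + r by omega] at this
    rwa [← this]
  have hhigh : c (i + 1) ≤ seqOps (List.replicate r false ++ [true]) c i := by
    rw [seqOps_append]
    refine le_seqOps_meet r _ i _ fun l hl hl' => ?_
    change _ ≤ max (c l) (c (l + 1))
    rcases Nat.eq_or_lt_of_le hl with rfl | hl
    · exact le_max_right _ _
    · have := flat (l - (i + 1)) (by omega)
      rw [show i + 1 + (l - (i + 1)) = l by omega] at this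
      rw [this]
      exact le_max_left _ _
  rw [heq] at hlow
  exact absurd hhigh (not_le.mpr hlow)

theorem SeqPermutable.seqLocallyMonotone {n p : ℕ} {c : ℕ → ℝ} (h : SeqPermutable n p c)
    (hpn : p ≤ n) (hc : ∀ i, n ≤ i → c (i + 1) = c i) : SeqLocallyMonotone p c := by
  intro i j hij hji h1
  have hi : i < n := by
    by_contra! hi
    exact h1.ne (hc i hi).symm
  rcases Nat.lt_or_ge j n with hj | hj
  swap
  · exact (hc j hj).ge
  rcases le_total i j with hle | hle
  · obtain ⟨r, rfl⟩ := Nat.exists_eq_add_of_le hle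
    exact h.not_peak r i (by omega) (by omega) hpn h1
  · obtain ⟨r, rfl⟩ := Nat.exists_eq_add_of_le hle
    by_contra! h2
    have := h.neg.not_peak r j (by omega) (by omega) hpn (by simpa using h2)
    simp only [Pi.neg_apply, neg_le_neg_iff] at this
    exact absurd this (not_le.mpr h1)

/-- The value of a symmetric function at the tuples of weight `k`. -/
def profile {n : ℕ} (f : (Fin n → Bool) → ℝ) (k : ℕ) : ℝ := f fun i => decide (i.val < k)

theorem profile_succ {n : ℕ} (f : (Fin n → Bool) → ℝ) (k : ℕ) (hk : n ≤ k) :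
    profile f (k + 1) = profile f k := by
  unfold profile
  congr 1
  funext i
  have := i.isLt
  rw [decide_eq_decide]
  omega

theorem card_filter_fin_val_lt {n k : ℕ} (hk : k ≤ n) :
    (univ.filter fun i : Fin n => i.val < k).card = k := by
  rw [Fin.card_filter_val_lt, min_eq_right hk]

theorem eq_profile_card {n : ℕ} (f : (Fin n → Bool) → ℝ)
    (hsym : ∀ σ : Equiv.Perm (Fin n), ∀ x : Fin n → Bool, f (x ∘ σ) = f x) (x : Fin n → Bool) :
    f x = profile f (univ.filter fun i => x i = true).card := by
  set k := (univ.filter fun i => x i = true).card with hk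
  have hkn : k ≤ n := by simpa using card_le_univ (univ.filter fun i => x i = true)
  have hcard : Fintype.card {i // x i = true} = Fintype.card {i : Fin n // i.val < k} := by
    rw [Fintype.card_subtype, Fintype.card_subtype, card_filter_fin_val_lt hkn]
  let e := Fintype.equivOfCardEq hcard
  rw [profile, ← hsym e.extendSubtype fun i => decide (i.val < k)]
  congr 1
  funext i
  cases hx : x i
  · simpa [hx] using e.extendSubtype_not_mem i (by simp [hx])
  · simpa [hx] using e.extendSubtype_mem i hx

theorem card_filter_update {ι : Type*} [Fintype ι] [DecidableEq ι] (P : ι → Prop)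
    [DecidablePred P] (k : ι) (hk : P k) (x : ι → Bool) (b : Bool) :
    (univ.filter fun i => P i ∧ Function.update x k b i = true).card =
      (univ.filter fun i => (i ≠ k ∧ P i) ∧ x i = true).card + b.toNat := by
  cases b
  · rw [Bool.toNat_false, Nat.add_zero]
    congr 1
    ext i
    by_cases h : i = k
    · simp [h]
    · simp [h]
  · rw [Bool.toNat_true, ← card_insert_of_notMem (a := k) (by simp)]
    congr 1
    ext i
    by_cases h : i = k
    · simp [h, hk]
    · simp [h]

theorem applyOps_eq_seqOps {ι : Type*} [Fintype ι] [DecidableEq ι] {f : (ι → Bool) → ℝ}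
    {c : ℕ → ℝ} (hf : ∀ x, f x = c (univ.filter fun i => x i = true).card)
    (l : List (Bool × ι)) (hl : (l.map Prod.snd).Nodup) (x : ι → Bool) :
    applyOps l f x = seqOps (l.map Prod.fst) c
      (univ.filter fun i => i ∉ l.map Prod.snd ∧ x i = true).card := by
  induction l generalizing x with
  | nil => simp [applyOps, seqOps, hf]
  | cons a l ih =>
    obtain ⟨b, k⟩ := a
    rw [List.map_cons, List.nodup_cons] at hl
    have step : ∀ v, applyOps l f (Function.update x k v) = seqOps (l.map Prod.fst) c
        ((univ.filter fun i => i ∉ ((b, k) :: l).map Prod.snd ∧ x i = true).card + v.toNat) := by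
      intro v
      rw [ih hl.2, card_filter_update (fun i => i ∉ l.map Prod.snd) k hl.1]
      simp only [List.map_cons, List.mem_cons, not_or, ne_eq]
    rw [List.map_cons, seqOps_cons]
    change latD (b, k) (applyOps l f) x = _
    cases b <;> simp [latD, meetD, joinD, seqOp, step]

theorem pderiv_eq_sub {ι : Type*} [Fintype ι] [DecidableEq ι] {f : (ι → Bool) → ℝ}
    {c : ℕ → ℝ} (hf : ∀ x, f x = c (univ.filter fun i => x i = true).card)
    (k : ι) (x : ι → Bool) :
    pderiv f k x = c ((univ.filter fun i => i ≠ k ∧ x i = true).card + 1) -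
      c (univ.filter fun i => i ≠ k ∧ x i = true).card := by
  have h := card_filter_update (fun _ => True) k trivial x
  simp only [true_and, and_true] at h
  simp [pderiv, hf, h]

theorem card_filter_le_add {ι : Type*} [Fintype ι] [DecidableEq ι] (P : ι → Prop)
    [DecidablePred P] (x y : ι → Bool) :
    (univ.filter fun i => P i ∧ x i = true).card ≤
      (univ.filter fun i => P i ∧ y i = true).card +
        (univ.filter fun i => P i ∧ x i ≠ y i).card := by
  refine (card_le_card fun i => ?_).trans (card_union_le _ _)
  simp only [mem_filter, mem_univ, true_and, mem_union]
  rintro ⟨hP, hx⟩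
  cases hy : y i <;> simp [hP, hx]

theorem locallyMonotone_iff_seqLocallyMonotone {n p : ℕ} {f : (Fin n → Bool) → ℝ} {c : ℕ → ℝ}
    (hf : ∀ x, f x = c (univ.filter fun i => x i = true).card)
    (hc : ∀ i, n ≤ i → c (i + 1) = c i) : LocallyMonotone p f ↔ SeqLocallyMonotone p c := by
  constructor
  · intro h i j hij hji h1
    have hi : i < n := by
      by_contra! hi
      exact h1.ne (hc i hi).symm
    rcases Nat.lt_or_ge j n with hj | hj
    swap
    · exact (hc j hj).ge
    let k : Fin n := ⟨n - 1, by omega⟩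
    have hw : ∀ s, s < n → (univ.filter fun a : Fin n =>
        a ≠ k ∧ decide (a.val < s) = true).card = s := by
      intro s hs
      rw [← card_filter_fin_val_lt hs.le]
      congr 1
      ext a
      simp only [mem_filter, mem_univ, true_and, decide_eq_true_eq, card_filter_fin_val_lt hs.le]
      refine ⟨fun ha => ha.2, fun ha => ⟨?_, ha⟩⟩
      rintro rfl
      simp only [k] at ha
      omega
    have hd : (univ.filter fun a : Fin n =>
        a ≠ k ∧ decide (a.val < i) ≠ decide (a.val < j)).card < p := by
      refine lt_of_le_of_lt (card_le_card_of_injOn (t := Ico (min i j) (max i j)) Fin.val ?_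
        Fin.val_injective.injOn) (by rw [Nat.card_Ico]; omega)
      intro a ha
      simp only [coe_filter, Set.mem_ofPred_eq, mem_univ, true_and, ne_eq, decide_eq_decide] at ha
      simp only [coe_Ico, Set.mem_Ico]
      omega
    have := h k (fun a => decide (a.val < i)) (fun a => decide (a.val < j)) hd
    rw [pderiv_eq_sub hf, pderiv_eq_sub hf, hw i hi, hw j hj] at this
    exact sub_nonneg.mp (nonneg_of_mul_nonneg_right this (sub_pos.mpr h1))
  · intro h k x y hxy
    rw [pderiv_eq_sub hf, pderiv_eq_sub hf]
    have h1 := card_filter_le_add (fun i => i ≠ k) x y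
    have h2 := card_filter_le_add (fun i => i ≠ k) y x
    simp only [ne_comm (a := y _)] at h2
    set s := (univ.filter fun i => i ≠ k ∧ x i = true).card
    set t := (univ.filter fun i => i ≠ k ∧ y i = true).card
    have h3 := h s t (by omega) (by omega)
    have h4 := h t s (by omega) (by omega)
    by_contra! h5
    rcases mul_neg_iff.mp h5 with ⟨h6, h7⟩ | ⟨h6, h7⟩
    · linarith [h3 (by linarith)]
    · linarith [h4 (by linarith)]

theorem List.Perm.exists_map_eq {α β : Type*} (g : α → β) (L : List α) (l' : List β)
    (h : (L.map g).Perm l') : ∃ L' : List α, L.Perm L' ∧ L'.map g = l' := by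
  obtain ⟨L', hL', hp⟩ := (congrFun₂ (List.eq_map_comp_perm g) l' L).mpr h.symm
  exact ⟨L', hp.symm, hL'.symm⟩

theorem Permutable.seqPermutable {n p : ℕ} {f : (Fin n → Bool) → ℝ} {c : ℕ → ℝ} (hpn : p ≤ n)
    (hf : ∀ x, f x = c (univ.filter fun i => x i = true).card)
    (h : Permutable p f) : SeqPermutable n p c := by
  intro l l' hl hp i hi
  let K : List (Fin n) := (List.finRange n).take p
  have hK : K.length = p := by simp [K, hpn]
  have hfst : (l.zip K).map Prod.fst = l := List.map_fst_zip (by omega)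
  have hsnd : (l.zip K).map Prod.snd = K := List.map_snd_zip (by omega)
  have hnd : K.Nodup := (List.nodup_finRange n).sublist (List.take_sublist _ _)
  obtain ⟨L, hL, hLl⟩ := List.Perm.exists_map_eq Prod.fst (l.zip K) l' (by rwa [hfst])
  have hcard : (univ.filter fun a => a ∉ K).card = n - p := by
    rw [filter_not, ← compl_eq_univ_sdiff, card_compl, Fintype.card_fin]
    congr 1
    rw [← hK, ← List.toFinset_card_of_nodup hnd]
    congr 1
    ext
    simp
  obtain ⟨S, hS, hSi⟩ := exists_subset_card_eq (n := i) (s := univ.filter fun a => a ∉ K) (by omega)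
  have key := congrFun (h _ _ (by simp [hK, hp]) (by rwa [hsnd]) hL) (fun a => decide (a ∈ S))
  have hLK : K.Perm (L.map Prod.snd) := hsnd ▸ hL.map Prod.snd
  rw [applyOps_eq_seqOps hf _ (by rwa [hsnd]), applyOps_eq_seqOps hf _ (hLK.nodup hnd),
    hfst, hsnd, hLl] at key
  simp only [← hLK.mem_iff] at key
  have hcS : (univ.filter fun a => a ∉ K ∧ decide (a ∈ S) = true).card = i := by
    rw [← hSi]
    congr 1
    ext a
    have := @hS a
    simp only [mem_filter, mem_univ, true_and] at this
    simpa using this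
  rwa [hcS] at key

theorem SeqLocallyMonotone.permutable {n p : ℕ} {f : (Fin n → Bool) → ℝ} {c : ℕ → ℝ}
    (hf : ∀ x, f x = c (univ.filter fun i => x i = true).card)
    (h : SeqLocallyMonotone p c) : Permutable p f := by
  intro l l' hp hl hll'
  funext x
  rw [applyOps_eq_seqOps hf _ hl, applyOps_eq_seqOps hf _ ((hll'.map _).nodup hl),
    h.seqOps_perm (hll'.map Prod.fst) (by simp [hp])]
  simp only [(hll'.map Prod.snd).mem_iff]

theorem stmt19 {n : ℕ} (p : ℕ) (hp : 1 ≤ p) (hpn : p ≤ n) (f : (Fin n → Bool) → ℝ)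
    (hsym : ∀ σ : Equiv.Perm (Fin n), ∀ x : Fin n → Bool, f (x ∘ σ) = f x) :
    LocallyMonotone p f ↔ Permutable p f := by
  have hf := eq_profile_card f hsym
  have hc := profile_succ f
  rw [locallyMonotone_iff_seqLocallyMonotone hf hc]
  exact ⟨SeqLocallyMonotone.permutable hf, fun h =>
    (Permutable.seqPermutable hpn hf h).seqLocallyMonotone hpn hc⟩
end
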